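/- arXiv:2104.14855 — 5 statements merged into one kernel-verified Lean document; each statement's English description precedes it below -/
import Mathlib

section
/- Let M_E be an invertible n_E×n_E real matrix, A an n_E×n_B real matrix, C₀ an n_B×n_B real matrix and Re_m a nonzero real number. Suppose S₀ := C₀ + Aᵀ·M_E⁻¹·A is invertible and that A·S₀⁻¹·Aᵀ = M_E. Then the matrix M := [M_E, −(1/Re_m)·A; Aᵀ, (1/Re_m)·C₀] is invertible and the top-left n_E×n_E block of M⁻¹ is the zero matrix. -/
open Matrix

theorem picard_2d_electromagnetic_inverse_topleft_block
    {nE nB : Type*} [Fintype nE] [Fintype nB] [DecidableEq nE] [DecidableEq nB]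
    (ME : Matrix nE nE ℝ) (A : Matrix nE nB ℝ) (C₀ : Matrix nB nB ℝ) (Rem : ℝ)
    (hRem : Rem ≠ 0)
    (hME : IsUnit ME)
    (hS₀ : IsUnit (C₀ + Aᵀ * ME⁻¹ * A))
    (hId : A * (C₀ + Aᵀ * ME⁻¹ * A)⁻¹ * Aᵀ = ME) :
    IsUnit (fromBlocks ME (-((1 / Rem) • A)) Aᵀ ((1 / Rem) • C₀)) ∧
      ((fromBlocks ME (-((1 / Rem) • A)) Aᵀ ((1 / Rem) • C₀))⁻¹).toBlocks₁₁ = 0 := by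
  set S := C₀ + Aᵀ * ME⁻¹ * A with hS
  have hSS : S * S⁻¹ = 1 := mul_nonsing_inv S ((isUnit_iff_isUnit_det S).mp hS₀)
  have hEE : ME * ME⁻¹ = 1 := mul_nonsing_inv ME ((isUnit_iff_isUnit_det ME).mp hME)
  have hEE' : ME⁻¹ * ME = 1 := nonsing_inv_mul ME ((isUnit_iff_isUnit_det ME).mp hME)
  have hC : C₀ = S - Aᵀ * ME⁻¹ * A := by rw [hS, add_sub_cancel_right]
  have hCS : C₀ * S⁻¹ * Aᵀ = 0 := by
    rw [hC, Matrix.sub_mul, Matrix.sub_mul, hSS, Matrix.one_mul, sub_eq_zero]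
    calc Aᵀ = Aᵀ * (ME⁻¹ * ME) := by rw [hEE', Matrix.mul_one]
      _ = Aᵀ * (ME⁻¹ * (A * S⁻¹ * Aᵀ)) := by rw [hId]
      _ = Aᵀ * ME⁻¹ * A * S⁻¹ * Aᵀ := by simp only [Matrix.mul_assoc]
  have hMN : fromBlocks ME (-((1 / Rem) • A)) Aᵀ ((1 / Rem) • C₀) *
      fromBlocks 0 (ME⁻¹ * A * S⁻¹) (-(Rem • (S⁻¹ * Aᵀ * ME⁻¹))) (Rem • S⁻¹) = 1 := by
    rw [fromBlocks_multiply, ← fromBlocks_one]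
    congr 1
    · simp [smul_smul, hRem, ← Matrix.mul_assoc, hId, hEE]
    · simp [smul_smul, hRem, ← Matrix.mul_assoc, hEE]
    · simp [← Matrix.mul_assoc, hCS]
    · simp only [Matrix.smul_mul, Matrix.mul_smul, smul_smul, ← Matrix.mul_assoc]
      rw [mul_one_div_cancel hRem, one_smul, ← Matrix.add_mul, add_comm, ← hS, hSS]
  refine ⟨IsUnit.of_mul_eq_one _ hMN, ?_⟩
  rw [inv_eq_right_inv hMN, toBlocks_fromBlocks₁₁]
end

section
/- Let R, W and Q be real inner product spaces, let curl : R → W and div : W → Q be linear maps with div ∘ curl = 0, and let Re_m > 0 be a real number. Suppose E ∈ R and B ∈ W satisfy the variational identity (1/Re_m)·⟨div B, div C⟩ + ⟨curl E, C⟩ = 0 for every C ∈ W. Then curl E = 0. -/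
open scoped RealInnerProductSpace

theorem augmented_formulation_curl_free
    {R W Q : Type*}
    [NormedAddCommGroup R] [InnerProductSpace ℝ R]
    [NormedAddCommGroup W] [InnerProductSpace ℝ W]
    [NormedAddCommGroup Q] [InnerProductSpace ℝ Q]
    (curl : R →ₗ[ℝ] W) (div : W →ₗ[ℝ] Q)
    (hcomplex : div ∘ₗ curl = 0)
    (Rem : ℝ) (hRem : 0 < Rem)
    (E : R) (B : W)
    (hvar : ∀ C : W, (1 / Rem) * ⟪div B, div C⟫ + ⟪curl E, C⟫ = 0) :
    curl E = 0 := by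
  have hdiv : div (curl E) = 0 := LinearMap.congr_fun hcomplex E
  simpa [hdiv] using hvar (curl E)
end

section
/- Let R, W and Q be real inner product spaces, let curl : R → W and div : W → Q be linear maps with div ∘ curl = 0, and let Re_m > 0 be a real number. Suppose E ∈ R and B ∈ W satisfy the variational identity (1/Re_m)·⟨div B, div C⟩ + ⟨curl E, C⟩ = 0 for every C ∈ W. Then div B = 0; that is, the augmented Lagrangian formulation enforces the magnetic Gauss law exactly. -/
open scoped RealInnerProductSpace

theorem augmented_formulation_enforces_gauss_law
    {R W Q : Type*}
    [NormedAddCommGroup R] [InnerProductSpace ℝ R]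
    [NormedAddCommGroup W] [InnerProductSpace ℝ W]
    [NormedAddCommGroup Q] [InnerProductSpace ℝ Q]
    (curl : R →ₗ[ℝ] W) (div : W →ₗ[ℝ] Q)
    (hcomplex : div ∘ₗ curl = 0)
    (Rem : ℝ) (hRem : 0 < Rem)
    (E : R) (B : W)
    (hvar : ∀ C : W, (1 / Rem) * ⟪div B, div C⟫ + ⟪curl E, C⟫ = 0) :
    div B = 0 := by
  have hdiv : div (curl E) = 0 := LinearMap.congr_fun hcomplex E
  have hcurl : curl E = 0 := by
    have h := hvar (curl E)
    rw [hdiv, inner_zero_right, mul_zero, zero_add] at h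
    exact inner_self_eq_zero.mp h
  have h := hvar B
  rw [hcurl, inner_zero_left, add_zero] at h
  exact inner_self_eq_zero.mp ((mul_eq_zero.mp h).resolve_left (one_div_pos.mpr hRem).ne')
end

section
/- Let R, W and Q be real vector spaces, and let curl : R → W and div : W → Q be linear maps with div ∘ curl = 0. Fix k ≥ 1, real multistep coefficients a₀, …, a_k with a_k ≠ 0, real coefficients b₀, …, b_k, and a real time step Δt. Suppose the sequences B : ℕ → W and E : ℕ → R satisfy, for every n ∈ ℕ, ∑_{i=0}^{k} a_i · B_{n+i} + Δt · ∑_{i=0}^{k} b_i · curl(E_{n+i}) = 0. If div(B_i) = 0 for all i < k, then div(B_n) = 0 for all n ∈ ℕ. -/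
theorem multistep_preserves_divergence_free
    {R W Q : Type*}
    [AddCommGroup R] [Module ℝ R]
    [AddCommGroup W] [Module ℝ W]
    [AddCommGroup Q] [Module ℝ Q]
    (curl : R →ₗ[ℝ] W) (div : W →ₗ[ℝ] Q)
    (hcomplex : div ∘ₗ curl = 0)
    (k : ℕ) (hk : 1 ≤ k)
    (a b : Fin (k + 1) → ℝ) (hak : a (Fin.last k) ≠ 0)
    (Δt : ℝ)
    (B : ℕ → W) (E : ℕ → R)
    (hrec : ∀ n : ℕ,
      (∑ i : Fin (k + 1), a i • B (n + i)) +
        Δt • (∑ i : Fin (k + 1), b i • curl (E (n + i))) = 0)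
    (hinit : ∀ i < k, div (B i) = 0) :
    ∀ n : ℕ, div (B n) = 0 := by
  have hdc (e : R) : div (curl e) = 0 := LinearMap.congr_fun hcomplex e
  intro n
  induction n using Nat.strong_induction_on with
  | _ n ih =>
    obtain hn | hn := lt_or_ge n k
    · exact hinit n hn
    obtain ⟨m, rfl⟩ := Nat.exists_eq_add_of_le' hn
    have h := congrArg div (hrec m)
    simp only [map_add, map_smul, map_sum, map_zero, hdc, smul_zero, Finset.sum_const_zero,
      add_zero] at h
    have hlower (i : Fin k) : div (B (m + i)) = 0 := ih _ (by omega)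
    rw [Fin.sum_univ_castSucc] at h
    simpa [hlower, hak] using h
end

section
/- Let F be an invertible n×n real matrix, M_p an invertible m×m real matrix, B an m×n real matrix, and γ a nonzero real number. Suppose S := B·F⁻¹·Bᵀ is invertible and γ⁻¹·M_p + S is invertible. Then the augmented momentum matrix F_γ := F + γ·Bᵀ·M_p⁻¹·B is invertible, S̃ := B·F_γ⁻¹·Bᵀ is invertible, and S̃⁻¹ = S⁻¹ + γ·M_p⁻¹; equivalently, the (negative) Schur complements S̃_NS := −B·F_γ⁻¹·Bᵀ and S_NS := −B·F⁻¹·Bᵀ of the saddle-point systems satisfy S̃_NS⁻¹ = S_NS⁻¹ − γ·M_p⁻¹. -/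
open Matrix

section Woodbury

variable {n m R : Type*} [Fintype n] [Fintype m] [DecidableEq n] [DecidableEq m] [CommRing R]

theorem isUnit_add_mul_mul {A : Matrix n n R} {U : Matrix n m R} {C : Matrix m m R}
    {V : Matrix m n R} (hA : IsUnit A) (hC : IsUnit C) (hAC : IsUnit (C⁻¹ + V * A⁻¹ * U)) :
    IsUnit (A + U * C * V) := by
  obtain ⟨_⟩ := hA.nonempty_invertible
  obtain ⟨_⟩ := hC.nonempty_invertible
  obtain ⟨iAC⟩ := hAC.nonempty_invertible
  simp only [← invOf_eq_nonsing_inv] at iAC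
  let := invertibleAddMulMul A U C V
  exact isUnit_of_invertible _

theorem mul_add_mul_mul_inv_mul_mul_inv_add {A : Matrix n n R} {U : Matrix n m R}
    {C : Matrix m m R} {V : Matrix m n R} (hA : IsUnit A) (hC : IsUnit C)
    (hS : IsUnit (V * A⁻¹ * U)) (hAC : IsUnit (C⁻¹ + V * A⁻¹ * U)) :
    V * (A + U * C * V)⁻¹ * U * ((V * A⁻¹ * U)⁻¹ + C) = 1 := by
  have hW : V * (A + U * C * V)⁻¹ * U =
      V * A⁻¹ * U - V * A⁻¹ * U * (C⁻¹ + V * A⁻¹ * U)⁻¹ * (V * A⁻¹ * U) := by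
    rw [add_mul_mul_inv_eq_sub A U C V hA hC hAC]
    simp only [Matrix.mul_sub, Matrix.sub_mul, Matrix.mul_assoc]
  rw [hW]
  generalize V * A⁻¹ * U = S at *
  have hSd := (isUnit_iff_isUnit_det _).1 hS
  have hCd := (isUnit_iff_isUnit_det _).1 hC
  have hTd := (isUnit_iff_isUnit_det _).1 hAC
  calc (S - S * (C⁻¹ + S)⁻¹ * S) * (S⁻¹ + C)
      = (S * ((C⁻¹ + S)⁻¹ * (C⁻¹ + S)) - S * (C⁻¹ + S)⁻¹ * S) * (S⁻¹ + C) := by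
        rw [nonsing_inv_mul _ hTd, Matrix.mul_one]
    _ = S * (C⁻¹ + S)⁻¹ * (C⁻¹ * S⁻¹ + C⁻¹ * C) := by noncomm_ring
    _ = S * (C⁻¹ + S)⁻¹ * (C⁻¹ * S⁻¹ + S * S⁻¹) := by
        rw [nonsing_inv_mul _ hCd, mul_nonsing_inv _ hSd]
    _ = S * ((C⁻¹ + S)⁻¹ * (C⁻¹ + S)) * S⁻¹ := by
        rw [← Matrix.add_mul]; simp only [Matrix.mul_assoc]
    _ = 1 := by rw [nonsing_inv_mul _ hTd, Matrix.mul_one, mul_nonsing_inv _ hSd]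

end Woodbury

theorem augmented_lagrangian_schur_complement_identity
    {n m : Type*} [Fintype n] [Fintype m] [DecidableEq n] [DecidableEq m]
    (F : Matrix n n ℝ) (Mp : Matrix m m ℝ) (B : Matrix m n ℝ) (γ : ℝ)
    (hF : IsUnit F) (hMp : IsUnit Mp) (hγ : γ ≠ 0)
    (hS : IsUnit (B * F⁻¹ * Bᵀ))
    (hMix : IsUnit (γ⁻¹ • Mp + B * F⁻¹ * Bᵀ)) :
    IsUnit (F + γ • (Bᵀ * Mp⁻¹ * B)) ∧
      IsUnit (B * (F + γ • (Bᵀ * Mp⁻¹ * B))⁻¹ * Bᵀ) ∧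
      (B * (F + γ • (Bᵀ * Mp⁻¹ * B))⁻¹ * Bᵀ)⁻¹ = (B * F⁻¹ * Bᵀ)⁻¹ + γ • Mp⁻¹ ∧
      (-(B * (F + γ • (Bᵀ * Mp⁻¹ * B))⁻¹ * Bᵀ))⁻¹ =
        (-(B * F⁻¹ * Bᵀ))⁻¹ - γ • Mp⁻¹ := by
  have hMpd := (isUnit_iff_isUnit_det _).1 hMp
  have hC : (γ • Mp⁻¹) * (γ⁻¹ • Mp) = 1 := by
    rw [smul_mul_smul_comm, mul_inv_cancel₀ hγ, nonsing_inv_mul _ hMpd, one_smul]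
  have hCu : IsUnit (γ • Mp⁻¹) := IsUnit.of_mul_eq_one _ hC
  rw [← inv_eq_right_inv hC] at hMix
  have hF_aug : γ • (Bᵀ * Mp⁻¹ * B) = Bᵀ * (γ • Mp⁻¹) * B := by
    rw [Matrix.mul_smul, Matrix.smul_mul]
  rw [hF_aug]
  have hmul := mul_add_mul_mul_inv_mul_mul_inv_add hF hCu hS hMix
  have hinv := inv_eq_right_inv hmul
  have neg_inv_eq {X Y : Matrix m m ℝ} (h : X * Y = 1) : (-X)⁻¹ = -Y :=
    inv_eq_right_inv (by rw [neg_mul_neg, h])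
  refine ⟨isUnit_add_mul_mul hF hCu hMix, IsUnit.of_mul_eq_one _ hmul, hinv, ?_⟩
  rw [neg_inv_eq hmul, neg_inv_eq (mul_nonsing_inv _ ((isUnit_iff_isUnit_det _).1 hS)),
    neg_add, sub_eq_add_neg]
end
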